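/- arXiv:1903.06594 — 3 statements merged into one kernel-verified Lean document; each statement's English description precedes it below -/
import Mathlib

section
/- For every f in H, ||P_{H_ρ} f||² = Σ_{j∈ℕ} ∫_X |⟨f, ψ_{j,x}⟩|² dρ(x), where P_{H_ρ} is the orthogonal projection onto H_ρ. In other words, the family {ψ_{j,x} : j ∈ ℕ, x ∈ X} is a continuous Parseval frame for H_ρ with respect to the measure (counting measure on ℕ) × ρ. -/
open MeasureTheory Filter

local notation "⟪" x ", " y "⟫" => @inner ℂ _ _ x y

/-- The support of a measure: the set of points all of whose open neighborhoods have
positive measure. -/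
def measSupport {X : Type*} [TopologicalSpace X] [MeasurableSpace X]
    (ρ : Measure X) : Set X :=
  {x | ∀ U : Set X, IsOpen U → x ∈ U → ρ U ≠ 0}

theorem ae_mem_measSupport {X : Type*} [TopologicalSpace X] [SecondCountableTopology X]
    [MeasurableSpace X] (ρ : Measure X) : ∀ᵐ x ∂ρ, x ∈ measSupport ρ := by
  refine measure_null_of_locally_null _ fun x hx => ?_
  have hx' : ¬ ∀ U : Set X, IsOpen U → x ∈ U → ρ U ≠ 0 := hx
  push Not at hx'
  obtain ⟨U, hU, hxU, h0⟩ := hx'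
  exact ⟨U, mem_nhdsWithin_of_mem_nhds (hU.mem_nhds hxU), h0⟩

theorem eq_zero_of_ae_eq_zero_of_mem_measSupport {X E : Type*} [TopologicalSpace X]
    [MeasurableSpace X] [TopologicalSpace E] [T1Space E] [Zero E] {ρ : Measure X} {g : X → E}
    (hg : Continuous g) (h : ∀ᵐ x ∂ρ, g x = 0) {x : X} (hx : x ∈ measSupport ρ) : g x = 0 := by
  by_contra hne
  exact hx {y | g y ≠ 0} (isOpen_compl_singleton.preimage hg) hne h

section DiagonalOperator

variable {H ι : Type*} [NormedAddCommGroup H] [InnerProductSpace ℂ H]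
  (v : HilbertBasis ι ℂ H) {A : H →L[ℂ] H} {a : ι → ℝ}

theorem HilbertBasis.inner_apply_of_diagonal (hA : ∀ i, A (v i) = ((a i : ℝ) : ℂ) • v i)
    (i : ι) (f : H) : ⟪v i, A f⟫ = a i * ⟪v i, f⟫ := by
  have h := ((v.hasSum_repr f).mapL A).mapL (innerSL ℂ (v i))
  refine (h.unique (hasSum_single i fun k hk => ?_)).trans ?_
  · simp [hA, v.orthonormal.2 hk.symm]
  · simp [hA, v.repr_apply_apply, v.orthonormal.1 i, mul_comm]

theorem HilbertBasis.inner_apply_comm_of_diagonal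
    (hA : ∀ i, A (v i) = ((a i : ℝ) : ℂ) • v i) (f g : H) : ⟪f, A g⟫ = ⟪A f, g⟫ := by
  rw [← v.tsum_inner_mul_inner f (A g), ← v.tsum_inner_mul_inner (A f) g]
  congr 1 with i
  rw [← inner_conj_symm (A f), v.inner_apply_of_diagonal hA, v.inner_apply_of_diagonal hA,
    map_mul, inner_conj_symm, Complex.conj_ofReal]
  ring

theorem HilbertBasis.hasSum_norm_inner_sq (f : H) :
    HasSum (fun i => ‖⟪v i, f⟫‖ ^ 2) (‖f‖ ^ 2) := by
  have h := Complex.hasSum_re (v.hasSum_inner_mul_inner f f)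
  convert h using 1
  · ext i
    change _ = RCLike.re (⟪f, v i⟫ * ⟪v i, f⟫)
    rw [inner_mul_symm_re_eq_norm, norm_mul, norm_inner_symm f, sq]
  · exact (inner_self_eq_norm_sq (𝕜 := ℂ) f).symm

end DiagonalOperator

section IntegralOperator

variable {X H : Type*} [TopologicalSpace X] [MeasurableSpace X] [BorelSpace X] {ρ : Measure X} [IsProbabilityMeasure ρ]
  [NormedAddCommGroup H] [InnerProductSpace ℂ H] {K : X → H} {κ : ℝ}

theorem integrable_inner_smul_feature [SecondCountableTopology X] (hK : Continuous K) (hKb : ∀ x, ‖K x‖ ≤ κ)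
    (f : H) : Integrable (fun x => ⟪K x, f⟫ • K x) ρ := by
  refine Integrable.of_bound (C := κ * ‖f‖ * κ)
    (Continuous.aestronglyMeasurable (by fun_prop)) (ae_of_all _ fun x => ?_)
  have hκ : 0 ≤ κ := (norm_nonneg _).trans (hKb x)
  rw [norm_smul]
  gcongr
  · exact (norm_inner_le_norm _ _).trans (by gcongr; exact hKb x)
  · exact hKb x

theorem integrable_norm_inner_feature_sq (hK : Continuous K) (hKb : ∀ x, ‖K x‖ ≤ κ) (f : H) :
    Integrable (fun x => ‖⟪f, K x⟫‖ ^ 2) ρ := by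
  refine Integrable.of_bound (C := (‖f‖ * κ) ^ 2)
    (Continuous.aestronglyMeasurable (by fun_prop)) (ae_of_all _ fun x => ?_)
  rw [norm_pow, norm_norm]
  gcongr
  exact (norm_inner_le_norm _ _).trans (by gcongr; exact hKb x)

variable [SecondCountableTopology X] [CompleteSpace H]

theorem inner_integral_feature (hK : Continuous K) (hKb : ∀ x, ‖K x‖ ≤ κ) (f g : H) :
    ⟪g, ∫ x, ⟪K x, f⟫ • K x ∂ρ⟫ = ∫ x, ⟪K x, f⟫ * ⟪g, K x⟫ ∂ρ := by
  rw [← integral_inner (integrable_inner_smul_feature hK hKb f)]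
  simp_rw [inner_smul_right]

theorem inner_integral_feature_self (hK : Continuous K) (hKb : ∀ x, ‖K x‖ ≤ κ) (f : H) :
    ⟪f, ∫ x, ⟪K x, f⟫ • K x ∂ρ⟫ = ((∫ x, ‖⟪f, K x⟫‖ ^ 2 ∂ρ : ℝ) : ℂ) := by
  rw [inner_integral_feature hK hKb, ← integral_complex_ofReal]
  congr 1 with x
  rw [← inner_conj_symm, Complex.conj_mul', Complex.ofReal_pow]

end IntegralOperator

/-- For every `f ∈ H`,
`‖P_{H_ρ} f‖² = Σ_{j∈ℕ} ∫_X |⟨f, ψ_{j,x}⟩|² dρ(x)`, where `P_{H_ρ}` is the orthogonal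
projection onto `H_ρ` (the closed span of `{K_x : x ∈ supp ρ}`): the family
`{ψ_{j,x} = G_j(T) K_x}` is a continuous Parseval frame for `H_ρ`.

The RKHS is encoded via the feature map `K : X → H` (so `f(x) = ⟪K x, f⟫` and the kernel is
`K(x,y) = ⟪K x, K y⟫`); the integral operator `T` is diagonalized by the Hilbert basis `v`
with eigenvalues `μ i ∈ [0, κ²]`, and `G_j(T)` is the operator `Gt j` acting as `G j (μ i)`
on each eigenvector. -/
theorem stmt0
    (X : Type*) [TopologicalSpace X] [LocallyCompactSpace X] [SecondCountableTopology X]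
    [MeasurableSpace X] [BorelSpace X]
    (ρ : Measure X) [IsProbabilityMeasure ρ]
    (H : Type*) [NormedAddCommGroup H] [InnerProductSpace ℂ H] [CompleteSpace H]
    (K : X → H) (hK : Continuous K)
    (κ : ℝ) (hκ : 0 < κ) (hKb : ∀ x, ‖K x‖ ≤ κ)
    (ι : Type*) (v : HilbertBasis ι ℂ H) (μ : ι → ℝ)
    (hμ : ∀ i, 0 ≤ μ i ∧ μ i ≤ κ ^ 2)
    (T : H →L[ℂ] H)
    (hT : ∀ f, T f = ∫ x, ⟪K x, f⟫ • K x ∂ρ)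
    (hTeig : ∀ i, T (v i) = ((μ i : ℝ) : ℂ) • v i)
    (G : ℕ → ℝ → ℝ)
    (hGmeas : ∀ j, Measurable (G j))
    (hGpos : ∀ j l, 0 ≤ l → 0 ≤ G j l)
    (hGsum : ∀ l ∈ Set.Ioc (0:ℝ) (κ ^ 2), HasSum (fun j : ℕ => l * G j l ^ 2) 1)
    (Gt : ℕ → H →L[ℂ] H)
    (hGt : ∀ j i, Gt j (v i) = ((G j (μ i) : ℝ) : ℂ) • v i)
    (ψ : ℕ → X → H) (hψ : ∀ j x, ψ j x = Gt j (K x))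
    (Hρ : Submodule ℂ H)
    (hHρ : Hρ = (Submodule.span ℂ (K '' measSupport ρ)).topologicalClosure)
    (P : H →L[ℂ] H)
    (hP : ∀ f : H, P f ∈ Hρ ∧ f - P f ∈ Hρᗮ) :
    ∀ f : H, ‖P f‖ ^ 2 = ∑' j : ℕ, ∫ x, ‖⟪f, ψ j x⟫‖ ^ 2 ∂ρ := by
  intro f
  subst hHρ
  set S := Submodule.span ℂ (K '' measSupport ρ) with hS
  have hTself (g : H) : ⟪g, T g⟫ = ((∫ x, ‖⟪g, K x⟫‖ ^ 2 ∂ρ : ℝ) : ℂ) := by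
    rw [hT, inner_integral_feature_self hK hKb]
  have hvker (i : ι) (hi : μ i = 0) : v i ∈ S.topologicalClosureᗮ := by
    rw [Submodule.orthogonal_closure]
    have h0 : ∫ x, ‖⟪v i, K x⟫‖ ^ 2 ∂ρ = 0 := by
      have := hTself (v i)
      rw [hTeig, hi, Complex.ofReal_zero, zero_smul, inner_zero_right] at this
      exact_mod_cast this.symm
    rw [integral_eq_zero_iff_of_nonneg (fun x => by positivity)
      (integrable_norm_inner_feature_sq hK hKb _)] at h0
    have hae : ∀ᵐ x ∂ρ, ⟪K x, v i⟫ = 0 := by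
      filter_upwards [h0] with x hx
      rw [← norm_eq_zero, norm_inner_symm]
      simpa using hx
    rw [hS, Submodule.mem_orthogonal]
    intro u hu
    induction hu using Submodule.span_induction with
    | mem u hu =>
      obtain ⟨x, hx, rfl⟩ := hu
      exact eq_zero_of_ae_eq_zero_of_mem_measSupport (by fun_prop) hae hx
    | zero => simp
    | add a b _ _ ha hb => rw [inner_add_left, ha, hb, add_zero]
    | smul c a _ ha => rw [inner_smul_left, ha, mul_zero]
  have hvrange (i : ι) (hi : μ i ≠ 0) : v i ∈ S.topologicalClosure := by
    rw [← Submodule.orthogonal_orthogonal_eq_closure, Submodule.mem_orthogonal]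
    intro w hw
    have h : ⟪w, T (v i)⟫ = 0 := by
      rw [hT, inner_integral_feature hK hKb]
      refine integral_eq_zero_of_ae ?_
      filter_upwards [ae_mem_measSupport ρ] with x hx
      rw [Submodule.inner_left_of_mem_orthogonal
        (Submodule.subset_span (Set.mem_image_of_mem K hx)) hw, mul_zero, Pi.zero_apply]
    rw [hTeig, inner_smul_right] at h
    exact (mul_eq_zero.mp h).resolve_left (by exact_mod_cast hi)
  have hcol (i : ι) :
      HasSum (fun j => μ i * G j (μ i) ^ 2 * ‖⟪v i, f⟫‖ ^ 2) (‖⟪v i, P f⟫‖ ^ 2) := by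
    by_cases hi : μ i = 0
    · rw [Submodule.inner_left_of_mem_orthogonal (hP f).1 (hvker i hi)]
      simp [hi, hasSum_zero]
    · have h := Submodule.inner_right_of_mem_orthogonal (hvrange i hi) (hP f).2
      rw [inner_sub_right, sub_eq_zero] at h
      rw [← h]
      simpa using (hGsum (μ i) ⟨lt_of_le_of_ne (hμ i).1 (Ne.symm hi), (hμ i).2⟩).mul_right
        (‖⟪v i, f⟫‖ ^ 2)
  have hrow (j : ℕ) :
      HasSum (fun i => μ i * G j (μ i) ^ 2 * ‖⟪v i, f⟫‖ ^ 2) (∫ x, ‖⟪f, ψ j x⟫‖ ^ 2 ∂ρ) := by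
    simp_rw [hψ, v.inner_apply_comm_of_diagonal (hGt j)]
    rw [← Complex.hasSum_ofReal, ← hTself]
    refine (v.hasSum_inner_mul_inner (Gt j f) (T (Gt j f))).congr_fun fun i => ?_
    rw [v.inner_apply_of_diagonal hTeig, ← inner_conj_symm (Gt j f),
      v.inner_apply_of_diagonal (hGt j), map_mul, Complex.conj_ofReal]
    push_cast
    rw [← Complex.conj_mul']
    ring
  have hsum : Summable fun p : ι × ℕ => μ p.1 * G p.2 (μ p.1) ^ 2 * ‖⟪v p.1, f⟫‖ ^ 2 := by
    rw [summable_prod_of_nonneg fun p =>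
      mul_nonneg (mul_nonneg (hμ p.1).1 (sq_nonneg _)) (sq_nonneg _)]
    refine ⟨fun i => (hcol i).summable, ?_⟩
    simp_rw [(hcol _).tsum_eq]
    exact (v.hasSum_norm_inner_sq (P f)).summable
  rw [← (v.hasSum_norm_inner_sq (P f)).tsum_eq]
  simp_rw [← (hcol _).tsum_eq, ← (hrow _).tsum_eq]
  exact hsum.tsum_comm.symm
end

section
/- Let A and B be self-adjoint Hilbert–Schmidt operators on a Hilbert space H, and let F : ℝ → ℂ be a Lipschitz continuous function with Lipschitz constant L and F(0) = 0. Then ||F(A) − F(B)||_HS ≤ L ||A − B||_HS, where F(A) and F(B) are defined by the functional calculus (equivalently, by applying F to the eigenvalues in orthonormal eigenbases of A and B) and ||·||_HS denotes the Hilbert–Schmidt norm. -/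
local notation "⟪" x ", " y "⟫" => @inner ℂ _ _ x y

/-- Parseval's identity for a Hilbert basis. -/
lemma HilbertBasis.hasSum_norm_inner_sq_s5 {ι H : Type*} [NormedAddCommGroup H]
    [InnerProductSpace ℂ H] (b : HilbertBasis ι ℂ H) (x : H) :
    HasSum (fun i => ‖inner ℂ (b i) x‖ ^ 2) (‖x‖ ^ 2) := by
  have h := (b.hasSum_inner_mul_inner x x).mapL Complex.reCLM
  have h2 : ∀ i, Complex.reCLM (inner ℂ x (b i) * inner ℂ (b i) x) = ‖inner ℂ (b i) x‖ ^ 2 := by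
    intro i
    rw [← inner_conj_symm x (b i), RCLike.conj_mul]
    simp [← Complex.ofReal_pow]
  have h3 : Complex.reCLM (inner ℂ x x) = ‖x‖ ^ 2 := by
    simp [inner_self_eq_norm_sq_to_K, ← Complex.ofReal_pow]
  simpa only [h2, h3] using h

/-- The coordinates of `G x` in a Hilbert basis that diagonalizes `G`. -/
lemma HilbertBasis.inner_apply_of_diagonal_s5 {ι H : Type*} [NormedAddCommGroup H]
    [InnerProductSpace ℂ H] (b : HilbertBasis ι ℂ H) (G : H →L[ℂ] H) (g : ι → ℂ)
    (hG : ∀ i, G (b i) = g i • b i) (j : ι) (x : H) :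
    inner ℂ (b j) (G x) = g j * inner ℂ (b j) x := by
  have h : (innerSL ℂ (b j)).comp G = g j • innerSL ℂ (b j) := by
    refine ContinuousLinearMap.ext_on
      (Submodule.dense_iff_topologicalClosure_eq_top.mpr b.dense_span) ?_
    rintro _ ⟨k, rfl⟩
    by_cases hjk : j = k
    · subst hjk
      simp [hG]
    · simp [hG, b.orthonormal.2 hjk]
  simpa using congrArg (fun T : H →L[ℂ] ℂ => T x) h

/-- A diagonalizable operator that is square summable along its eigenbasis is square summable along
every Hilbert basis. -/
lemma HilbertBasis.summable_norm_sq_of_diagonal {ι ι' H : Type*} [NormedAddCommGroup H]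
    [InnerProductSpace ℂ H] (e : HilbertBasis ι ℂ H) (b : HilbertBasis ι' ℂ H)
    (G : H →L[ℂ] H) (g : ι' → ℂ) (hG : ∀ j, G (b j) = g j • b j)
    (hs : Summable fun j => ‖G (b j)‖ ^ 2) : Summable fun i => ‖G (e i)‖ ^ 2 := by
  have hrow : ∀ j, HasSum (fun i => ‖inner ℂ (b j) (G (e i))‖ ^ 2) (‖G (b j)‖ ^ 2) := by
    intro j
    have h := (e.hasSum_norm_inner_sq_s5 (b j)).mul_left (‖g j‖ ^ 2)
    simpa only [b.inner_apply_of_diagonal_s5 G g hG, hG, norm_smul, norm_mul, mul_pow,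
      norm_inner_symm (b j)] using h
  have hprod : Summable fun p : ι' × ι => ‖inner ℂ (b p.1) (G (e p.2))‖ ^ 2 := by
    refine (summable_prod_of_nonneg fun _ => by positivity).2 ⟨fun j => (hrow j).summable, ?_⟩
    simpa only [(hrow _).tsum_eq] using hs
  have h := hprod.prod_symm.prod
  simpa only [Prod.fst_swap, Prod.snd_swap, (b.hasSum_norm_inner_sq_s5 _).tsum_eq] using h

/-- Let `A` and `B` be self-adjoint Hilbert–Schmidt operators on a Hilbert
space `H` (given by orthonormal eigenbases `e`, `b` with real eigenvalues `la`, `lb`), and let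
`F : ℝ → ℂ` be Lipschitz with constant `L` and `F(0) = 0`. Then
`‖F(A) − F(B)‖_HS ≤ L ‖A − B‖_HS`, where `F(A)`, `F(B)` are defined by applying `F` to the
eigenvalues, and the Hilbert–Schmidt norm is computed as `‖M‖_HS² = Σ_i ‖M e_i‖²` in an
orthonormal basis (here the basis `e`). -/
theorem stmt5 (H : Type*) [NormedAddCommGroup H] [InnerProductSpace ℂ H] [CompleteSpace H]
    (ι ι' : Type*) (e : HilbertBasis ι ℂ H) (b : HilbertBasis ι' ℂ H)
    (A B : H →L[ℂ] H) (la : ι → ℝ) (lb : ι' → ℝ)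
    (hA : ∀ i, A (e i) = ((la i : ℝ) : ℂ) • e i)
    (hB : ∀ i, B (b i) = ((lb i : ℝ) : ℂ) • b i)
    (hAHS : Summable fun i => ‖A (e i)‖ ^ 2)
    (hBHS : Summable fun i => ‖B (b i)‖ ^ 2)
    (F : ℝ → ℂ) (L : ℝ) (hL : 0 ≤ L)
    (hF : ∀ s t : ℝ, ‖F s - F t‖ ≤ L * |s - t|) (hF0 : F 0 = 0)
    (FA FB : H →L[ℂ] H)
    (hFA : ∀ i, FA (e i) = F (la i) • e i)
    (hFB : ∀ i, FB (b i) = F (lb i) • b i) :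
    Real.sqrt (∑' i, ‖FA (e i) - FB (e i)‖ ^ 2) ≤
      L * Real.sqrt (∑' i, ‖A (e i) - B (e i)‖ ^ 2) := by
  have hpt : ∀ i, ‖FA (e i) - FB (e i)‖ ^ 2 ≤ L ^ 2 * ‖A (e i) - B (e i)‖ ^ 2 := by
    intro i
    refine hasSum_le (fun j => ?_) (b.hasSum_norm_inner_sq_s5 _)
      ((b.hasSum_norm_inner_sq_s5 _).mul_left (L ^ 2))
    rw [inner_sub_right, inner_sub_right, b.inner_apply_of_diagonal_s5 FB _ hFB,
      b.inner_apply_of_diagonal_s5 B _ hB, hFA, hA, inner_smul_right, inner_smul_right, ← sub_mul,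
      ← sub_mul, norm_mul, norm_mul, ← Complex.ofReal_sub, Complex.norm_real, Real.norm_eq_abs,
      ← mul_pow, ← mul_assoc]
    gcongr
    exact hF _ _
  have hBe := e.summable_norm_sq_of_diagonal b B _ hB hBHS
  have hsum : Summable fun i => ‖A (e i) - B (e i)‖ ^ 2 := by
    refine .of_nonneg_of_le (fun _ => by positivity) (fun i => ?_) ((hAHS.add hBe).mul_left 2)
    have h := norm_sub_le (A (e i)) (B (e i))
    nlinarith [norm_nonneg (A (e i) - B (e i)), sq_nonneg (‖A (e i)‖ - ‖B (e i)‖)]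
  have hsumL := hsum.mul_left (L ^ 2)
  have hsumF := Summable.of_nonneg_of_le (fun _ => by positivity) hpt hsumL
  calc Real.sqrt (∑' i, ‖FA (e i) - FB (e i)‖ ^ 2)
      ≤ Real.sqrt (L ^ 2 * ∑' i, ‖A (e i) - B (e i)‖ ^ 2) := by
        rw [← tsum_mul_left]
        exact Real.sqrt_le_sqrt (hsumF.tsum_le_tsum hpt hsumL)
    _ = L * Real.sqrt (∑' i, ‖A (e i) - B (e i)‖ ^ 2) := by
        rw [Real.sqrt_mul (sq_nonneg L), Real.sqrt_sq hL]
end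

section
/- Let x_1,…,x_N be independent samples drawn from ρ. Then the operators T and T̂ are Hilbert–Schmidt, and for every t > 0, with probability at least 1 − 2e^{−t}, ||T − T̂||_HS ≤ 2√2 κ² √t N^{−1/2}. -/
open MeasureTheory Filter
open scoped ENNReal

local notation "⟪" x ", " y "⟫" => @inner ℂ _ _ x y

/-- Fubini's theorem for a power of a probability measure, splitting off the first coordinate. -/
theorem integral_pi_fin_succ {X E : Type*} [MeasurableSpace X] (ρ : Measure X)
    [IsProbabilityMeasure ρ] [NormedAddCommGroup E] [NormedSpace ℝ E] {n : ℕ}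
    {F : (Fin (n + 1) → X) → E} (hF : Integrable F (Measure.pi fun _ => ρ)) :
    Integrable (fun x => ∫ y, F (Fin.cons x y) ∂Measure.pi fun _ : Fin n => ρ) ρ ∧
      ∫ z, F z ∂(Measure.pi fun _ => ρ) =
        ∫ x, ∫ y, F (Fin.cons x y) ∂(Measure.pi fun _ : Fin n => ρ) ∂ρ := by
  have hp := (measurePreserving_piFinSuccAbove (fun _ : Fin (n + 1) => ρ) 0).symm
  have hcons : ∀ p : X × (Fin n → X),
      (MeasurableEquiv.piFinSuccAbove (fun _ => X) 0).symm p =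
        (Fin.cons p.1 p.2 : Fin (n + 1) → X) := by
    intro p
    simp [MeasurableEquiv.piFinSuccAbove_symm_apply, Fin.insertNthEquiv]
  have hint : Integrable (fun p : X × (Fin n → X) => F (Fin.cons p.1 p.2))
      (ρ.prod (Measure.pi fun _ => ρ)) := by
    have := hp.integrable_comp_of_integrable hF
    simpa only [Function.comp_def, hcons] using this
  refine ⟨hint.integral_prod_left, ?_⟩
  rw [← hp.integral_comp']
  simp only [hcons]
  exact integral_prod _ hint

theorem measurable_fin_cons {X : Type*} [MeasurableSpace X] {n : ℕ} :
    Measurable fun p : X × (Fin n → X) => (Fin.cons p.1 p.2 : Fin (n + 1) → X) := by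
  refine measurable_pi_iff.2 fun i => ?_
  refine Fin.cases ?_ (fun j => ?_) i
  · simpa using measurable_fst
  · simpa [Function.comp_def] using (measurable_pi_apply j).comp measurable_snd

theorem integrable_of_measurable_of_abs_le {Ω : Type*} [MeasurableSpace Ω] {μ : Measure Ω}
    [IsFiniteMeasure μ] {f : Ω → ℝ} (hf : Measurable f) {B : ℝ} (hB : ∀ x, |f x| ≤ B) :
    Integrable f μ :=
  Integrable.of_bound hf.aestronglyMeasurable B (ae_of_all _ hB)

theorem integrable_exp_mul_sub_of_abs_le {Ω : Type*} [MeasurableSpace Ω] {μ : Measure Ω}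
    [IsFiniteMeasure μ] {f : Ω → ℝ} (hf : Measurable f) {B : ℝ} (hB : ∀ x, |f x| ≤ B)
    (l m : ℝ) : Integrable (fun x => Real.exp (l * (f x - m))) μ := by
  refine integrable_of_measurable_of_abs_le (B := Real.exp (|l| * (B + |m|))) (by fun_prop) ?_
  intro x
  rw [abs_of_pos (Real.exp_pos _)]
  refine Real.exp_le_exp.2 ((le_abs_self _).trans ?_)
  rw [abs_mul]
  gcongr
  exact (abs_sub _ _).trans (by gcongr; exact hB x)

/-- The exponential moment bound behind McDiarmid's bounded differences inequality. -/
theorem integral_exp_le_of_bounded_differences {X : Type*} [MeasurableSpace X] (ρ : Measure X)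
    [IsProbabilityMeasure ρ] {c B : ℝ} (hc : 0 ≤ c) (l : ℝ) (n : ℕ) :
    ∀ F : (Fin n → X) → ℝ, Measurable F → (∀ z, |F z| ≤ B) →
      (∀ z i a, |F (Function.update z i a) - F z| ≤ c) →
      ∫ z, Real.exp (l * (F z - ∫ w, F w ∂Measure.pi fun _ => ρ)) ∂(Measure.pi fun _ => ρ) ≤
        Real.exp (n * (c / 2) ^ 2 * l ^ 2 / 2) := by
  induction n with
  | zero =>
    intro F _ _ _
    have h : ∀ z w, F z = F w := fun z w => congrArg F (Subsingleton.elim _ _)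
    have h' : ∀ z, F z - ∫ w, F w ∂(Measure.pi fun _ => ρ) = 0 := by
      intro z
      simp [h _ z]
    simp [h']
  | succ n ih =>
    intro F hF hB hd
    set m := ∫ w, F w ∂(Measure.pi fun _ => ρ) with hm
    set g : X → ℝ := fun x => ∫ y, F (Fin.cons x y) ∂(Measure.pi fun _ : Fin n => ρ) with hg
    have hFi := integral_pi_fin_succ ρ
      (integrable_of_measurable_of_abs_le (μ := Measure.pi fun _ => ρ) hF hB)
    have hFc : ∀ x, Measurable fun y : Fin n → X => F (Fin.cons x y) := fun x =>
      (hF.comp measurable_fin_cons).comp measurable_prodMk_left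
    have hFci : ∀ x, Integrable (fun y : Fin n → X => F (Fin.cons x y))
        (Measure.pi fun _ => ρ) := fun x =>
      integrable_of_measurable_of_abs_le (hFc x) fun y => hB _
    have hgm : Measurable g :=
      (hF.comp measurable_fin_cons).stronglyMeasurable.integral_prod_right'.measurable
    have hgB : ∀ x, |g x| ≤ B := by
      intro x
      simpa using norm_integral_le_of_norm_le_const (μ := Measure.pi fun _ : Fin n => ρ)
        (f := fun y => F (Fin.cons x y)) (ae_of_all _ fun y => hB (Fin.cons x y))
    have hgd : ∀ x x', g x ≤ g x' + c := by
      intro x x'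
      have : g x ≤ ∫ y, (F (Fin.cons x' y) + c) ∂(Measure.pi fun _ : Fin n => ρ) := by
        refine integral_mono (hFci x) ((hFci x').add (integrable_const c)) fun y => ?_
        have := hd (Fin.cons x' y) 0 x
        rw [Fin.update_cons_zero] at this
        linarith [le_abs_self (F (Fin.cons x y) - F (Fin.cons x' y))]
      rwa [integral_add (hFci x') (integrable_const c), integral_const, probReal_univ,
        one_smul] at this
    have hne : Nonempty X := nonempty_of_isProbabilityMeasure ρ
    have hbdd : BddBelow (Set.range g) :=
      ⟨-B, by rintro _ ⟨x, rfl⟩; exact (abs_le.1 (hgB x)).1⟩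
    have hIcc : ∀ x, g x ∈ Set.Icc (⨅ x, g x) ((⨅ x, g x) + c) := fun x =>
      ⟨ciInf_le hbdd x, sub_le_iff_le_add.1 (le_ciInf fun x' => sub_le_iff_le_add.2 (hgd x x'))⟩
    have hgexp : ∫ x, Real.exp (l * (g x - m)) ∂ρ ≤ Real.exp ((c / 2) ^ 2 * l ^ 2 / 2) := by
      have := (ProbabilityTheory.hasSubgaussianMGF_of_mem_Icc (μ := ρ) hgm.aemeasurable
        (ae_of_all _ hIcc)).mgf_le l
      rw [hm, hFi.2]
      simpa [ProbabilityTheory.mgf, abs_of_nonneg hc] using this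
    have hinner : ∀ x, ∫ y, Real.exp (l * (F (Fin.cons x y) - m))
        ∂(Measure.pi fun _ : Fin n => ρ) ≤
          Real.exp (l * (g x - m)) * Real.exp (n * (c / 2) ^ 2 * l ^ 2 / 2) := by
      intro x
      have hx := ih (fun y => F (Fin.cons x y)) (hFc x) (fun y => hB _) (fun y i a => by
        rw [Fin.cons_update]
        exact hd _ _ _)
      have hsplit : ∀ y : Fin n → X, Real.exp (l * (F (Fin.cons x y) - m)) =
          Real.exp (l * (g x - m)) * Real.exp (l * (F (Fin.cons x y) - g x)) := by
        intro y
        rw [← Real.exp_add]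
        congr 1
        ring
      simp only [hsplit]
      rw [integral_const_mul]
      exact mul_le_mul_of_nonneg_left hx (Real.exp_pos _).le
    have hexp := integral_pi_fin_succ ρ
      (integrable_exp_mul_sub_of_abs_le (μ := Measure.pi fun _ => ρ) hF hB l m)
    rw [hexp.2]
    calc _ ≤ ∫ x, Real.exp (l * (g x - m)) * Real.exp (n * (c / 2) ^ 2 * l ^ 2 / 2) ∂ρ :=
          integral_mono hexp.1
            ((integrable_exp_mul_sub_of_abs_le hgm hgB l m).mul_const _) hinner
      _ = (∫ x, Real.exp (l * (g x - m)) ∂ρ) * Real.exp (n * (c / 2) ^ 2 * l ^ 2 / 2) :=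
          integral_mul_const _ _
      _ ≤ Real.exp ((c / 2) ^ 2 * l ^ 2 / 2) * Real.exp (n * (c / 2) ^ 2 * l ^ 2 / 2) := by
          gcongr
      _ = _ := by
          rw [← Real.exp_add]
          congr 1
          push_cast
          ring

/-- McDiarmid's bounded differences inequality, in sub-Gaussian form. -/
theorem hasSubgaussianMGF_of_bounded_differences {X : Type*} [MeasurableSpace X] (ρ : Measure X)
    [IsProbabilityMeasure ρ] {B : ℝ} (c : NNReal) {n : ℕ} {F : (Fin n → X) → ℝ}
    (hF : Measurable F) (hB : ∀ z, |F z| ≤ B)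
    (hd : ∀ z i a, |F (Function.update z i a) - F z| ≤ c) :
    ProbabilityTheory.HasSubgaussianMGF
      (fun z => F z - ∫ w, F w ∂Measure.pi fun _ => ρ) (n * (c / 2) ^ 2)
      (Measure.pi fun _ => ρ) where
  integrable_exp_mul l := integrable_exp_mul_sub_of_abs_le hF hB l _
  mgf_le l := by
    simpa [ProbabilityTheory.mgf] using
      integral_exp_le_of_bounded_differences ρ c.2 l n F hF hB hd

theorem stronglyMeasurable_sum_pi {X E : Type*} [MeasurableSpace X]
    [NormedAddCommGroup E] {ξ : X → E} (hξ : StronglyMeasurable ξ) (n : ℕ) :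
    StronglyMeasurable fun z : Fin n → X => ∑ i, ξ (z i) :=
  Finset.stronglyMeasurable_fun_sum _ fun i _ => hξ.comp_measurable (measurable_pi_apply i)

theorem norm_sum_pi_le {X E : Type*} [NormedAddCommGroup E] {ξ : X → E} {B : ℝ}
    (hB : ∀ x, ‖ξ x‖ ≤ B) {n : ℕ} (z : Fin n → X) :
    ‖∑ i, ξ (z i)‖ ≤ n * B := by
  simpa using norm_sum_le_of_le Finset.univ fun i _ => hB (z i)

section Hilbert

variable {X E : Type*} [MeasurableSpace X] (ρ : Measure X) [IsProbabilityMeasure ρ]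
  [NormedAddCommGroup E] [InnerProductSpace ℂ E] [CompleteSpace E]

theorem integral_norm_add_sq {ξ : X → E} (hξ : StronglyMeasurable ξ) {B : ℝ}
    (hB : ∀ x, ‖ξ x‖ ≤ B) (v : E) :
    ∫ x, ‖v + ξ x‖ ^ 2 ∂ρ =
      ‖v‖ ^ 2 + 2 * RCLike.re ⟪v, ∫ x, ξ x ∂ρ⟫ + ∫ x, ‖ξ x‖ ^ 2 ∂ρ := by
  have hi : Integrable ξ ρ := Integrable.of_bound hξ.aestronglyMeasurable B (ae_of_all _ hB)
  have hi2 : Integrable (fun x => ‖ξ x‖ ^ 2) ρ :=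
    integrable_of_measurable_of_abs_le (B := B ^ 2) (hξ.norm.measurable.pow_const 2) fun x => by
      rw [abs_of_nonneg (by positivity)]
      gcongr
      exact hB x
  have hin : Integrable (fun x => ⟪v, ξ x⟫) ρ := hi.const_inner v
  have hre : Integrable (fun x => RCLike.re ⟪v, ξ x⟫) ρ := hin.re
  simp_rw [fun x => norm_add_sq (𝕜 := ℂ) v (ξ x)]
  have hlin : Integrable (fun x => ‖v‖ ^ 2 + 2 * RCLike.re ⟪v, ξ x⟫) ρ :=
    (integrable_const _).add (hre.const_mul 2)
  rw [integral_add hlin hi2, integral_add (integrable_const _) (hre.const_mul 2),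
    integral_const_mul, integral_re hin, integral_inner hi]
  simp

theorem integral_norm_add_sum_sq {ξ : X → E} (hξ : StronglyMeasurable ξ) {B : ℝ}
    (hB : ∀ x, ‖ξ x‖ ≤ B) (h0 : ∫ x, ξ x ∂ρ = 0) (n : ℕ) :
    ∀ v : E, ∫ z, ‖v + ∑ i, ξ (z i)‖ ^ 2 ∂(Measure.pi fun _ : Fin n => ρ) =
      ‖v‖ ^ 2 + n * ∫ x, ‖ξ x‖ ^ 2 ∂ρ := by
  induction n with
  | zero => simp
  | succ n ih =>
    intro v
    have hi : Integrable (fun z : Fin (n + 1) → X => ‖v + ∑ i, ξ (z i)‖ ^ 2)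
        (Measure.pi fun _ => ρ) := by
      refine integrable_of_measurable_of_abs_le (B := (‖v‖ + (n + 1 : ℕ) * B) ^ 2)
        ((stronglyMeasurable_const.add
          (stronglyMeasurable_sum_pi hξ _)).norm.measurable.pow_const 2) fun z => ?_
      rw [abs_of_nonneg (by positivity)]
      gcongr
      exact (norm_add_le _ _).trans (by gcongr; exact norm_sum_pi_le hB z)
    rw [(integral_pi_fin_succ ρ hi).2]
    simp only [Fin.sum_univ_succ, Fin.cons_zero, Fin.cons_succ, ← add_assoc, ih]
    have hi1 : Integrable (fun x => ‖v + ξ x‖ ^ 2) ρ := by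
      refine integrable_of_measurable_of_abs_le (B := (‖v‖ + B) ^ 2)
        ((stronglyMeasurable_const.add hξ).norm.measurable.pow_const 2) fun x => ?_
      rw [abs_of_nonneg (by positivity)]
      gcongr
      exact (norm_add_le _ _).trans (by gcongr; exact hB x)
    rw [integral_add hi1 (integrable_const _), integral_norm_add_sq ρ hξ hB, h0]
    simp
    ring

/-- The expected deviation of an empirical mean of bounded vectors in a Hilbert space. -/
theorem integral_norm_mean_sub_le {Φ : X → E} (hΦ : StronglyMeasurable Φ) {C : ℝ} (hC0 : 0 ≤ C)
    (hC : ∀ x, ‖Φ x‖ ≤ C) {N : ℕ} (hN : 1 ≤ N) :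
    ∫ z, ‖(∫ x, Φ x ∂ρ) - (N : ℂ)⁻¹ • ∑ i, Φ (z i)‖ ∂(Measure.pi fun _ : Fin N => ρ) ≤
      C / √N := by
  set m := ∫ x, Φ x ∂ρ with hm
  have hmC : ‖m‖ ≤ C := by
    simpa using norm_integral_le_of_norm_le_const (μ := ρ) (ae_of_all _ hC)
  have hNpos : (0 : ℝ) < N := by exact_mod_cast hN
  have hNne : (N : ℂ) ≠ 0 := by exact_mod_cast hNpos.ne'
  have hΦi : Integrable Φ ρ := Integrable.of_bound hΦ.aestronglyMeasurable C (ae_of_all _ hC)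
  have hξ : StronglyMeasurable fun x => -m + Φ x := stronglyMeasurable_const.add hΦ
  have hξB : ∀ x, ‖-m + Φ x‖ ≤ C + C := fun x =>
    (norm_add_le _ _).trans (add_le_add (by rwa [norm_neg]) (hC x))
  have hξ0 : ∫ x, (-m + Φ x) ∂ρ = 0 := by
    rw [integral_add (integrable_const _) hΦi]
    simp [← hm]
  have hvar : ∫ x, ‖-m + Φ x‖ ^ 2 ∂ρ ≤ C ^ 2 := by
    rw [integral_norm_add_sq ρ hΦ hC, ← hm, inner_neg_left, inner_self_eq_norm_sq_to_K]
    have h1 : ∫ x, ‖Φ x‖ ^ 2 ∂ρ ≤ C ^ 2 := by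
      have := integral_mono_of_nonneg (μ := ρ) (f := fun x => ‖Φ x‖ ^ 2) (g := fun _ => C ^ 2)
        (ae_of_all _ fun x => by positivity) (integrable_const _)
        (ae_of_all _ fun x => pow_le_pow_left₀ (norm_nonneg _) (hC x) 2)
      simpa using this
    have h2 : RCLike.re (-((‖m‖ : ℂ) ^ 2)) = -‖m‖ ^ 2 := by
      norm_cast
    have h3 := sq_nonneg ‖m‖
    rw [RCLike.ofReal_eq_complex_ofReal, h2, norm_neg]
    linarith
  have hdev : ∀ z : Fin N → X, ‖m - (N : ℂ)⁻¹ • ∑ i, Φ (z i)‖ =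
      (N : ℝ)⁻¹ * ‖(0 : E) + ∑ i, (-m + Φ (z i))‖ := by
    intro z
    have : m - (N : ℂ)⁻¹ • ∑ i, Φ (z i) =
        -((N : ℂ)⁻¹ • ((0 : E) + ∑ i, (-m + Φ (z i)))) := by
      rw [zero_add, Finset.sum_add_distrib, smul_add]
      simp only [Finset.sum_const, Finset.card_univ, Fintype.card_fin]
      rw [← Nat.cast_smul_eq_nsmul ℂ, smul_smul, inv_mul_cancel₀ hNne, one_smul]
      abel
    rw [this, norm_neg, norm_smul]
    simp
  set S : (Fin N → X) → ℝ := fun z => ‖(0 : E) + ∑ i, (-m + Φ (z i))‖ with hS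
  have hSm : Measurable S :=
    (stronglyMeasurable_const.add (stronglyMeasurable_sum_pi hξ N)).norm.measurable
  have hS2 : ∫ z, S z ^ 2 ∂(Measure.pi fun _ => ρ) ≤ N * C ^ 2 := by
    rw [integral_norm_add_sum_sq ρ hξ hξB hξ0 N 0]
    simp only [norm_zero]
    nlinarith
  have hSL : MemLp S 2 (Measure.pi fun _ => ρ) :=
    MemLp.of_bound hSm.aestronglyMeasurable (N * (C + C)) (ae_of_all _ fun z => by
      rw [Real.norm_of_nonneg (norm_nonneg _)]
      simpa using norm_sum_pi_le hξB z)
  have hvarS := ProbabilityTheory.variance_nonneg S (Measure.pi fun _ => ρ)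
  rw [ProbabilityTheory.variance_eq_sub hSL] at hvarS
  have hle : ∫ z, S z ∂(Measure.pi fun _ => ρ) ≤ √N * C := by
    refine le_of_sq_le_sq ?_ (by positivity)
    rw [mul_pow, Real.sq_sqrt hNpos.le]
    exact (sub_nonneg.1 hvarS).trans hS2
  simp only [hdev]
  rw [integral_const_mul]
  calc (N : ℝ)⁻¹ * ∫ z, S z ∂(Measure.pi fun _ => ρ) ≤ (N : ℝ)⁻¹ * (√N * C) := by gcongr
    _ = C / √N := by
      have := Real.sq_sqrt hNpos.le
      have h' : √(N : ℝ) ≠ 0 := (Real.sqrt_pos.2 hNpos).ne'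
      field_simp
      nlinarith

/-- A Hoeffding inequality for empirical means of bounded vectors in a Hilbert space. -/
theorem measure_norm_mean_sub_le {Φ : X → E} (hΦ : StronglyMeasurable Φ) {C : ℝ} (hC0 : 0 < C)
    (hC : ∀ x, ‖Φ x‖ ≤ C) {N : ℕ} (hN : 1 ≤ N) {t : ℝ} (ht : 0 < t) :
    ENNReal.ofReal (1 - 2 * Real.exp (-t)) ≤ (Measure.pi fun _ : Fin N => ρ)
      {z | ‖(∫ x, Φ x ∂ρ) - (N : ℂ)⁻¹ • ∑ i, Φ (z i)‖ ≤ 2 * √2 * C * √t / √N} := by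
  rcases le_total t (1 / 2) with hts | hts
  · rw [ENNReal.ofReal_of_nonpos]
    · exact zero_le
    · linarith [Real.add_one_le_exp (-t)]
  set m := ∫ x, Φ x ∂ρ with hm
  have hmC : ‖m‖ ≤ C := by
    simpa using norm_integral_le_of_norm_le_const (μ := ρ) (ae_of_all _ hC)
  have hNpos : (0 : ℝ) < N := by exact_mod_cast hN
  set P := Measure.pi fun _ : Fin N => ρ
  set F : (Fin N → X) → ℝ := fun z => ‖m - (N : ℂ)⁻¹ • ∑ i, Φ (z i)‖ with hF
  set c : NNReal := NNReal.mk (2 * C / N) (by positivity) with hc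
  have hFm : Measurable F :=
    (stronglyMeasurable_const.sub
      ((stronglyMeasurable_sum_pi hΦ N).const_smul _)).norm.measurable
  have hFB : ∀ z, |F z| ≤ C + (N : ℝ)⁻¹ * (N * C) := by
    intro z
    rw [abs_of_nonneg (norm_nonneg _)]
    refine (norm_sub_le _ _).trans (add_le_add hmC ?_)
    rw [norm_smul, norm_inv, Complex.norm_natCast]
    gcongr
    exact norm_sum_pi_le hC z
  have hFd : ∀ z i a, |F (Function.update z i a) - F z| ≤ c := by
    intro z i a
    refine (abs_norm_sub_norm_le _ _).trans ?_
    have hsum : ∑ j, Φ (z j) - ∑ j, Φ (Function.update z i a j) = Φ (z i) - Φ a := by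
      rw [← Finset.sum_sub_distrib, Finset.sum_eq_single i]
      · simp
      · intro j _ hj
        simp [hj]
      · simp
    rw [sub_sub_sub_cancel_left, ← smul_sub, hsum, norm_smul, norm_inv, Complex.norm_natCast]
    have : ‖Φ (z i) - Φ a‖ ≤ 2 * C :=
      (norm_sub_le _ _).trans (by linarith [hC (z i), hC a])
    calc (N : ℝ)⁻¹ * ‖Φ (z i) - Φ a‖ ≤ (N : ℝ)⁻¹ * (2 * C) := by gcongr
      _ = c := by
        rw [hc, NNReal.coe_mk]
        ring
  have hmean : ∫ z, F z ∂P ≤ C / √N := integral_norm_mean_sub_le ρ hΦ hC0.le hC hN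
  set s := C * (√2 * √t) / √N with hs
  have hs0 : 0 ≤ s := by positivity
  have htail := (hasSubgaussianMGF_of_bounded_differences ρ c hFm hFB hFd).measure_ge_le hs0
  have hexp : -s ^ 2 / (2 * ((N * (c / 2) ^ 2 : NNReal) : ℝ)) = -t := by
    have h2 : √(2 : ℝ) ^ 2 = 2 := Real.sq_sqrt (by norm_num)
    have h3 : √t ^ 2 = t := Real.sq_sqrt ht.le
    have h4 : √(N : ℝ) ^ 2 = N := Real.sq_sqrt hNpos.le
    have h5 : (c : ℝ) = 2 * C / N := rfl
    push_cast
    rw [hs, h5, div_pow, mul_pow, mul_pow, h2, h3, h4]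
    field_simp
  rw [hexp] at htail
  have hsub : {z | F z ≤ 2 * √2 * C * √t / √N}ᶜ ⊆ {z | s ≤ F z - ∫ w, F w ∂P} := by
    intro z hz
    simp only [Set.mem_compl_iff, Set.mem_ofPred_eq, not_le] at hz ⊢
    have h1 : 1 ≤ √2 * √t := by
      rw [← Real.sqrt_mul (by norm_num)]
      exact Real.one_le_sqrt.2 (by linarith)
    have h2 : C / √N + s ≤ 2 * √2 * C * √t / √N := by
      rw [hs, ← add_div]
      gcongr
      nlinarith
    linarith
  have hmeas : MeasurableSet {z | F z ≤ 2 * √2 * C * √t / √N} :=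
    measurableSet_le hFm measurable_const
  have hcompl : P.real {z | F z ≤ 2 * √2 * C * √t / √N}ᶜ ≤ Real.exp (-t) :=
    (measureReal_mono hsub).trans htail
  rw [probReal_compl_eq_one_sub hmeas] at hcompl
  rw [← ofReal_measureReal]
  exact ENNReal.ofReal_le_ofReal (by linarith [Real.exp_pos (-t)])

end Hilbert

section HilbertSchmidt

variable {H ι : Type*} [NormedAddCommGroup H] [InnerProductSpace ℂ H]
  (e : HilbertBasis ι ℂ H)

theorem HilbertBasis.hasSum_norm_inner_smul_sq (u v : H) :
    HasSum (fun i => ‖⟪u, e i⟫ • v‖ ^ 2) ((‖u‖ * ‖v‖) ^ 2) := by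
  have h := (lp.hasSum_norm (p := 2) (by norm_num) (e.repr u)).mul_right (‖v‖ ^ 2)
  simp only [ENNReal.toReal_ofNat, Real.rpow_two, e.repr.norm_map, e.repr_apply_apply] at h
  rw [mul_pow]
  simpa only [norm_smul, mul_pow, norm_inner_symm u] using h

/-- The coordinates `i ↦ ⟪u, e i⟫ • v` of the rank-one operator `f ↦ ⟪u, f⟫ • v` in the
Hilbert basis `e`, as a square-summable family. -/
noncomputable def HilbertBasis.rankOne (u v : H) : lp (fun _ : ι => H) 2 :=
  ⟨fun i => ⟪u, e i⟫ • v, memℓp_gen <| by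
    simpa using (e.hasSum_norm_inner_smul_sq u v).summable⟩

theorem HilbertBasis.rankOne_apply (u v : H) (i : ι) : e.rankOne u v i = ⟪u, e i⟫ • v := rfl

theorem HilbertBasis.norm_rankOne (u v : H) : ‖e.rankOne u v‖ = ‖u‖ * ‖v‖ := by
  have h := lp.hasSum_norm (p := 2) (by norm_num) (e.rankOne u v)
  simp only [ENNReal.toReal_ofNat, Real.rpow_two, e.rankOne_apply] at h
  exact (pow_left_inj₀ (norm_nonneg _) (by positivity) two_ne_zero).1
    (h.unique (e.hasSum_norm_inner_smul_sq u v))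

theorem HilbertBasis.continuous_rankOne : Continuous fun p : H × H => e.rankOne p.1 p.2 := by
  let L : H →L⋆[ℂ] H →L[ℂ] lp (fun _ : ι => H) 2 :=
    LinearMap.mkContinuous₂
      (LinearMap.mk₂'ₛₗ (starRingEnd ℂ) (RingHom.id ℂ) e.rankOne
        (fun u u' v => by ext i; simp [e.rankOne_apply, add_smul])
        (fun a u v => by ext i; simp [e.rankOne_apply, smul_smul, mul_comm])
        (fun u v v' => by ext i; simp [e.rankOne_apply])
        (fun a u v => by ext i; simp [e.rankOne_apply, smul_comm a]))
      1 (fun u v => by simp [e.norm_rankOne])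
  exact (L.continuous.comp continuous_fst).clm_apply continuous_snd

end HilbertSchmidt

/-- Let `x_1,…,x_N` be independent samples drawn from `ρ` (i.e. a point of
`X^N` distributed according to the product measure `ρ^{⊗N}`). Then the operators `T` and `T̂`
are Hilbert–Schmidt, and for every `t > 0`, with probability at least `1 − 2e^{−t}`,
`‖T − T̂‖_HS ≤ 2√2 κ² √t N^{−1/2}`.

Here `T = ∫ K_x ⊗ K_x dρ(x)`, `T̂ = (1/N) Σ_i K_{x_i} ⊗ K_{x_i}` (encoded via the feature map
`K : X → H`), and the Hilbert–Schmidt norm is computed as `‖M‖_HS² = Σ_i ‖M e_i‖²` in a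
Hilbert basis `e` of `H`. -/
theorem stmt6
    (X : Type*) [TopologicalSpace X] [LocallyCompactSpace X] [SecondCountableTopology X]
    [MeasurableSpace X] [BorelSpace X]
    (ρ : Measure X) [IsProbabilityMeasure ρ]
    (H : Type*) [NormedAddCommGroup H] [InnerProductSpace ℂ H] [CompleteSpace H]
    (K : X → H) (hK : Continuous K)
    (κ : ℝ) (hκ : 0 < κ) (hKb : ∀ x, ‖K x‖ ≤ κ)
    (ι : Type*) (e : HilbertBasis ι ℂ H)
    (T : H →L[ℂ] H)
    (hT : ∀ f, T f = ∫ x, ⟪K x, f⟫ • K x ∂ρ)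
    (N : ℕ) (hN : 1 ≤ N)
    (That : (Fin N → X) → H →L[ℂ] H)
    (hThat : ∀ xs f, That xs f = (N : ℂ)⁻¹ • ∑ i, ⟪K (xs i), f⟫ • K (xs i))
    (t : ℝ) (ht : 0 < t) :
    Summable (fun i => ‖T (e i)‖ ^ 2) ∧
    (∀ xs, Summable fun i => ‖That xs (e i)‖ ^ 2) ∧
    ENNReal.ofReal (1 - 2 * Real.exp (-t)) ≤
      Measure.pi (fun _ : Fin N => ρ)
        {xs | Real.sqrt (∑' i, ‖T (e i) - That xs (e i)‖ ^ 2) ≤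
          2 * Real.sqrt 2 * κ ^ 2 * Real.sqrt t / Real.sqrt N} := by
  set Φ : X → lp (fun _ : ι => H) 2 := fun x => e.rankOne (K x) (K x) with hΦ
  have hΦm : StronglyMeasurable Φ :=
    (e.continuous_rankOne.comp (hK.prodMk hK)).stronglyMeasurable
  have hΦC : ∀ x, ‖Φ x‖ ≤ κ ^ 2 := fun x => by
    rw [hΦ, e.norm_rankOne, ← sq]
    exact pow_le_pow_left₀ (norm_nonneg _) (hKb x) 2
  have hΦi : Integrable Φ ρ :=
    Integrable.of_bound hΦm.aestronglyMeasurable _ (ae_of_all _ hΦC)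
  have hTe : ∀ i, T (e i) = (∫ x, Φ x ∂ρ : lp (fun _ : ι => H) 2) i := fun i => by
    rw [hT]
    exact (lp.evalCLM ℂ (fun _ : ι => H) 2 i).integral_comp_comm hΦi
  have hThate : ∀ xs i, That xs (e i) = ((N : ℂ)⁻¹ • ∑ j, Φ (xs j)) i := fun xs i => by
    rw [hThat, lp.coeFn_smul, Pi.smul_apply, lp.coeFn_sum, Finset.sum_apply]
    rfl
  have hsq : ∀ f : lp (fun _ : ι => H) 2, HasSum (fun i => ‖f i‖ ^ 2) (‖f‖ ^ 2) := fun f => by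
    simpa using lp.hasSum_norm (p := 2) (by norm_num) f
  refine ⟨?_, fun xs => ?_, ?_⟩
  · simpa only [hTe] using (hsq _).summable
  · simpa only [hThate] using (hsq _).summable
  · have hdist : ∀ xs, √(∑' i, ‖T (e i) - That xs (e i)‖ ^ 2) =
        ‖(∫ x, Φ x ∂ρ) - (N : ℂ)⁻¹ • ∑ j, Φ (xs j)‖ := fun xs => by
      simp only [hTe, hThate, ← Pi.sub_apply, ← lp.coeFn_sub, (hsq _).tsum_eq]
      exact Real.sqrt_sq (norm_nonneg _)
    simp only [hdist]
    exact measure_norm_mean_sub_le ρ hΦm (by positivity) hΦC hN ht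
end
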